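/- arXiv:2002.05078 — 2 statements merged into one kernel-verified Lean document; each statement's English description precedes it below -/
import Mathlib

section
/- Let {X_α : α ∈ Λ} be a family of almost separable topological spaces, each having a nonempty countable almost dense subset, where the index set Λ has cardinality at most 𝔠 = 2^{ℵ₀}. Then the product space ∏_{α∈Λ} X_α with the product topology is almost separable. -/
/-- A subset `A` of a topological space `X` is almost dense if every continuous
real-valued function vanishing on `A` vanishes on all of `X`. -/
def AlmostDense {X : Type*} [TopologicalSpace X] (A : Set X) : Prop :=
  ∀ f : X → ℝ, Continuous f → (∀ a ∈ A, f a = 0) → ∀ x : X, f x = 0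

/-- A topological space is almost separable if it has a countable almost dense subset. -/
def AlmostSeparable (X : Type*) [TopologicalSpace X] : Prop :=
  ∃ A : Set X, A.Countable ∧ AlmostDense A

open Filter in
/-- Finitely many binary sequences are pairwise distinguished by their initial segments of some
common length. -/
theorem exists_injOn_initialSegment {ι : Type*} (r : ι → ℕ → Bool) (hr : Function.Injective r)
    (F : Finset ι) : ∃ n : ℕ, Set.InjOn (fun i (k : Fin n) => r i k) F := by
  have key : ∀ᶠ n : ℕ in atTop, ∀ i ∈ F, ∀ j ∈ F,
      (fun k : Fin n => r i k) = (fun k : Fin n => r j k) → i = j := by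
    simp only [eventually_all_finset]
    intro i _ j _
    by_cases hij : i = j
    · exact .of_forall fun _ _ => hij
    · obtain ⟨k, hk⟩ := Function.ne_iff.mp (hr.ne hij)
      filter_upwards [eventually_gt_atTop k] with n hn heq
      exact absurd (congrFun heq ⟨k, hn⟩) hk
  obtain ⟨n, hn⟩ := key.exists
  exact ⟨n, fun i hi j hj h => hn i hi j hj h⟩

/-- For an index set of size at most the continuum, there is a countable family of functions to `ℕ`
realizing every assignment of values on every finite set of indices. -/
theorem exists_countable_interpolating {ι : Type*} (hι : Cardinal.mk ι ≤ Cardinal.continuum) :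
    ∃ D : Set (ι → ℕ), D.Countable ∧
      ∀ (p : ι → ℕ) (F : Finset ι), ∃ d ∈ D, ∀ i ∈ F, d i = p i := by
  have hle : Cardinal.lift.{0} (Cardinal.mk ι) ≤ Cardinal.lift (Cardinal.mk (ℕ → Bool)) := by
    simpa using hι
  obtain ⟨r⟩ := Cardinal.lift_mk_le'.mp hle
  refine ⟨Set.range fun (s : Σ n : ℕ, (Fin n → Bool) → ℕ) i => s.2 fun k => r i k,
    Set.countable_range _, fun p F => ?_⟩
  obtain ⟨n, hn⟩ := exists_injOn_initialSegment r r.injective F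
  obtain ⟨φ, hφ⟩ : ∃ φ : (Fin n → Bool) → ℕ, ∀ i ∈ F, φ (fun k => r i k) = p i := by
    rcases isEmpty_or_nonempty ι with _ | _
    · exact ⟨0, fun i => isEmptyElim i⟩
    · exact ⟨fun s => p (Function.invFunOn (fun i (k : Fin n) => r i k) F s),
        fun i hi => congrArg p (hn.leftInvOn_invFunOn hi)⟩
  exact ⟨_, ⟨⟨n, φ⟩, rfl⟩, hφ⟩

/-- A point of an open subset of a product stays in it when changed outside a suitable finite set of
coordinates. -/
theorem IsOpen.exists_finset_forall_eq_mem {ι : Type*} {X : ι → Type*}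
    [∀ i, TopologicalSpace (X i)] {U : Set (∀ i, X i)} (hU : IsOpen U) {x : ∀ i, X i}
    (hx : x ∈ U) : ∃ F : Finset ι, ∀ y : ∀ i, X i, (∀ i ∈ F, y i = x i) → y ∈ U := by
  obtain ⟨F, u, hu, hsub⟩ := isOpen_pi_iff.mp hU x hx
  exact ⟨F, fun y hy => hsub fun i hi => by rw [hy i hi]; exact (hu i hi).2⟩

/-- A continuous function vanishing on a product of almost dense sets also vanishes at the points
with only finitely many coordinates outside these sets. -/
theorem AlmostDense.eq_zero_of_forall_notMem_finset {ι : Type*} {X : ι → Type*}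
    [∀ i, TopologicalSpace (X i)] {A : ∀ i, Set (X i)} (hA : ∀ i, AlmostDense (A i))
    {f : (∀ i, X i) → ℝ} (hf : Continuous f) (h0 : ∀ x ∈ Set.univ.pi A, f x = 0)
    (F : Finset ι) : ∀ x : ∀ i, X i, (∀ i ∉ F, x i ∈ A i) → f x = 0 := by
  classical
  induction F using Finset.induction_on with
  | empty => exact fun x hx => h0 x fun i _ => hx i (Finset.notMem_empty i)
  | insert a F _ ih =>
    intro x hx
    have h := hA a (fun t => f (Function.update x a t))
      (hf.comp (continuous_const.update a continuous_id)) (fun t ht => ih _ fun i hi => ?_) (x a)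
    · simpa using h
    · by_cases hia : i = a
      · subst hia
        simpa using ht
      · simpa [hia] using hx i (by simp [hia, hi])

/-- A product of nonempty almost dense sets is almost dense. -/
theorem AlmostDense.univ_pi {ι : Type*} {X : ι → Type*} [∀ i, TopologicalSpace (X i)]
    {A : ∀ i, Set (X i)} (hA : ∀ i, AlmostDense (A i)) (hne : ∀ i, (A i).Nonempty) :
    AlmostDense (Set.univ.pi A) := by
  classical
  intro f hf h0 x
  by_contra hx
  obtain ⟨F, hF⟩ := (isOpen_ne_fun hf continuous_const).exists_finset_forall_eq_mem hx
  choose c hc using hne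
  refine hF (fun i => if i ∈ F then x i else c i) (fun i hi => if_pos hi)
    (eq_zero_of_forall_notMem_finset hA hf h0 F _ fun i hi => ?_)
  simpa [hi] using hc i

theorem almostSeparable_pi_continuum {Λ : Type*} (X : Λ → Type*)
    [∀ α, TopologicalSpace (X α)]
    (hcard : Cardinal.mk Λ ≤ Cardinal.continuum)
    (h : ∀ α, ∃ A : Set (X α), A.Nonempty ∧ A.Countable ∧ AlmostDense A) :
    AlmostSeparable (∀ α, X α) := by
  choose A hne hcount hA using h
  choose g hg using fun α => (hcount α).exists_eq_range (hne α)
  obtain ⟨D, hD, hint⟩ := exists_countable_interpolating hcard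
  refine ⟨(fun d α => g α (d α)) '' D, hD.image _, fun f hf h0 =>
    AlmostDense.univ_pi hA hne f hf fun x hx => ?_⟩
  by_contra hfx
  obtain ⟨F, hF⟩ := (isOpen_ne_fun hf continuous_const).exists_finset_forall_eq_mem hfx
  have hx' : ∀ α, ∃ n, g α n = x α := fun α => by
    simpa [hg α] using hx α (Set.mem_univ α)
  choose p hp using hx'
  obtain ⟨d, hd, hdp⟩ := hint p F
  exact hF _ (fun α hα => by simp only [hdp α hα, hp α]) (h0 _ ⟨d, hd, rfl⟩)
end

section
/- Let X be a functionally Hausdorff, almost separable topological space. Then the cardinality of X is at most 2^𝔠, where 𝔠 = 2^{ℵ₀}. -/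
/-- A topological space is functionally Hausdorff if distinct points can be
separated by a continuous real-valued function. -/
def FunctionallyHausdorff (X : Type*) [TopologicalSpace X] : Prop :=
  ∀ a b : X, a ≠ b → ∃ f : X → ℝ, Continuous f ∧ f a = 0 ∧ f b = 1

theorem AlmostDense.eq_of_eqOn {X : Type*} [TopologicalSpace X] {A : Set X}
    (hA : AlmostDense A) {f g : X → ℝ} (hf : Continuous f) (hg : Continuous g)
    (hfg : Set.EqOn f g A) (x : X) : f x = g x :=
  sub_eq_zero.mp <| hA (fun y => f y - g y) (hf.sub hg) (fun _ ha => sub_eq_zero.mpr (hfg ha)) x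

/-- The traces on `A` of the continuous functions vanishing at a point determine the point. -/
theorem FunctionallyHausdorff.injective_domRestrict {X : Type*} [TopologicalSpace X]
    (hX : FunctionallyHausdorff X) {A : Set X} (hA : AlmostDense A) :
    Function.Injective fun x : X =>
      {g : A → ℝ | ∃ f : X → ℝ, Continuous f ∧ f x = 0 ∧ A.domRestrict f = g} := by
  intro a b hab
  by_contra hne
  obtain ⟨f, hf, hfa, hfb⟩ := hX a b hne
  obtain ⟨g, hg, hgb, hgf⟩ := (Set.ext_iff.mp hab (A.domRestrict f)).mp ⟨f, hf, hfa, rfl⟩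
  have heq : g b = f b := hA.eq_of_eqOn hg hf (fun x hx => congrFun hgf ⟨x, hx⟩) b
  rw [hgb, hfb] at heq
  exact zero_ne_one heq

theorem Set.Countable.mk_real_functions_le {X : Type*} {A : Set X} (hA : A.Countable) :
    Cardinal.mk (A → ℝ) ≤ Cardinal.continuum := by
  rw [Cardinal.mk_arrow, Cardinal.mk_real, Cardinal.lift_continuum, Cardinal.lift_uzero]
  calc Cardinal.continuum ^ Cardinal.mk A
      ≤ Cardinal.continuum ^ Cardinal.aleph0 :=
        Cardinal.power_le_power_left Cardinal.continuum_ne_zero hA.le_aleph0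
    _ = Cardinal.continuum := Cardinal.continuum_power_aleph0

theorem card_le_two_pow_continuum {X : Type*} [TopologicalSpace X]
    (hfH : FunctionallyHausdorff X) (h : AlmostSeparable X) :
    Cardinal.mk X ≤ 2 ^ Cardinal.continuum := by
  obtain ⟨A, hA, hdense⟩ := h
  calc Cardinal.mk X ≤ Cardinal.mk (Set (A → ℝ)) :=
        Cardinal.mk_le_of_injective (hfH.injective_domRestrict hdense)
    _ = 2 ^ Cardinal.mk (A → ℝ) := Cardinal.mk_set
    _ ≤ 2 ^ Cardinal.continuum :=
        Cardinal.power_le_power_left two_ne_zero hA.mk_real_functions_le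
end
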